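/- Given a smooth function (α, κ) : [0,c] → ℝ² and initial data (p, v) ∈ X × S, there exists a unique Legendre curve (γ, η) : [0,c] → X × S with curvature pair (α, κ) satisfying γ(0) = p and η(0) = v. -/

import Mathlib

open scoped Topology
open Set

variable {X : Type*}

/-- Birkhoff orthogonality: `x` is Birkhoff orthogonal to `y`. -/
def BirkhoffOrth [NormedAddCommGroup X] [NormedSpace ℝ X] (x y : X) : Prop :=
  ∀ t : ℝ, ‖x‖ ≤ ‖x + t • y‖

open scoped NNReal

section Field

variable [NormedAddCommGroup X] [NormedSpace ℝ X]

lemma BirkhoffOrth.smul_right {x y : X} (h : BirkhoffOrth x y) (s : ℝ) :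
    BirkhoffOrth x (s • y) := fun t => by
  simpa [smul_smul] using h (t * s)

lemma BirkhoffOrth.fderiv_norm_eq_zero {x y : X} (h : BirkhoffOrth x y)
    (hx : DifferentiableAt ℝ (fun x : X => ‖x‖) x) :
    fderiv ℝ (fun x : X => ‖x‖) x y = 0 := by
  have hline : HasDerivAt (fun t : ℝ => x + t • y) y 0 := by
    simpa using ((hasDerivAt_id (0 : ℝ)).smul_const y).const_add x
  have hcomp : HasDerivAt (fun t : ℝ => ‖x + t • y‖) (fderiv ℝ (fun x : X => ‖x‖) x y) 0 := by
    have hx' : HasFDerivAt (fun x : X => ‖x‖) (fderiv ℝ (fun x : X => ‖x‖) x)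
        (x + (0 : ℝ) • y) := by simpa using hx.hasFDerivAt
    exact hx'.comp_hasDerivAt 0 hline
  refine IsLocalMin.hasDerivAt_eq_zero (Filter.Eventually.of_forall fun t => ?_) hcomp
  simpa using h t

/-- In a plane, the Birkhoff normal direction is the normalized `ω`-gradient of the norm, hence it
depends smoothly on the point. -/
lemma contDiffOn_birkhoff [FiniteDimensional ℝ X] (hdim : Module.finrank ℝ X = 2)
    (hnorm : ContDiffOn ℝ (⊤ : ℕ∞) (fun x : X => ‖x‖) {x : X | x ≠ 0})
    (ω : X →ₗ[ℝ] X →ₗ[ℝ] ℝ) (hωalt : ∀ x : X, ω x x = 0)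
    (hωnd : ∀ x : X, x ≠ 0 → ∃ y : X, ω x y ≠ 0) (b : X → X)
    (hb : ∀ v : X, v ≠ 0 → ‖b v‖ = 1 ∧ BirkhoffOrth v (b v) ∧ 0 < ω v (b v)) :
    ContDiffOn ℝ (⊤ : ℕ∞) b {x : X | x ≠ 0} := by
  have hopen : IsOpen {x : X | x ≠ 0} := isOpen_ne
  have hdiff : ∀ x : X, x ≠ 0 → DifferentiableAt ℝ (fun x : X => ‖x‖) x := fun x hx =>
    (hnorm.contDiffAt (hopen.mem_nhds hx)).differentiableAt (by simp)
  have hanti : ∀ x y : X, ω x y = -ω y x := fun x y => by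
    have h := hωalt (x + y)
    simp only [map_add, LinearMap.add_apply, hωalt] at h
    linarith
  have hinj : Function.Injective ω := by
    rw [← LinearMap.ker_eq_bot, LinearMap.ker_eq_bot']
    intro x hx
    by_contra hne
    obtain ⟨y, hy⟩ := hωnd x hne
    exact hy (by simp [hx])
  let e : X ≃ₗ[ℝ] Module.Dual ℝ X :=
    LinearMap.linearEquivOfInjective ω hinj Subspace.dual_finrank_eq.symm
  have he : ∀ f : Module.Dual ℝ X, ω (e.symm f) = f := fun f => e.apply_symm_apply f
  let L : (X →L[ℝ] ℝ) →L[ℝ] X :=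
    LinearMap.toContinuousLinearMap
      (-(e.symm.toLinearMap ∘ₗ ContinuousLinearMap.coeLM ℝ))
  have hL : ∀ (f : X →L[ℝ] ℝ) (y : X), ω (L f) y = -f y := fun f y => by
    have : L f = -e.symm (f : X →ₗ[ℝ] ℝ) := rfl
    rw [this, map_neg, LinearMap.neg_apply, he]
    rfl
  let J : X → X := fun x => L (fderiv ℝ (fun x : X => ‖x‖) x)
  have hJ : ContDiffOn ℝ (⊤ : ℕ∞) J {x : X | x ≠ 0} :=
    L.contDiff.comp_contDiffOn (hnorm.fderiv_of_isOpen hopen (by simp))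
  have hωJ : ∀ x : X, x ≠ 0 → ω x (J x) = ‖x‖ := fun x hx => by
    rw [hanti, hL, neg_neg]
    exact (hdiff x hx).fderiv_norm_self
  have hJ0 : ∀ x : X, x ≠ 0 → J x ≠ 0 := fun x hx h0 => by
    have := hωJ x hx
    rw [h0, map_zero] at this
    exact hx (norm_eq_zero.mp this.symm)
  have hJnorm : ContDiffOn ℝ (⊤ : ℕ∞) (fun x => ‖J x‖) {x : X | x ≠ 0} :=
    hnorm.comp hJ fun x hx => hJ0 x hx
  refine ((hJnorm.inv fun x hx => norm_ne_zero_iff.mpr (hJ0 x hx)).smul hJ).congr fun x hx => ?_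
  obtain ⟨hb1, hb2, hb3⟩ := hb x hx
  have hωJx : ω (J x) ≠ 0 := fun h0 => by
    obtain ⟨y, hy⟩ := hωnd _ (hJ0 x hx)
    exact hy (by simp [h0])
  have hker : Module.finrank ℝ (LinearMap.ker (ω (J x))) = 1 := by
    have := Module.Dual.finrank_ker_add_one_of_ne_zero (f := ω (J x)) hωJx
    omega
  have hbker : b x ∈ LinearMap.ker (ω (J x)) := by
    rw [LinearMap.mem_ker, hL, hb2.fderiv_norm_eq_zero (hdiff x hx), neg_zero]
  obtain ⟨r, hr⟩ := (finrank_eq_one_iff_of_nonzero'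
    (⟨J x, LinearMap.mem_ker.mpr (hωalt _)⟩ : LinearMap.ker (ω (J x)))
    (fun h => hJ0 x hx (congrArg Subtype.val h))).mp hker ⟨b x, hbker⟩
  have hr' : r • J x = b x := congrArg Subtype.val hr
  have hrpos : 0 < r := by
    rw [← hr', map_smul, hωJ x hx, smul_eq_mul] at hb3
    exact pos_of_mul_pos_left hb3 (norm_nonneg x)
  rw [← hr', norm_smul, Real.norm_of_nonneg hrpos.le] at hb1
  rw [← hr', eq_inv_of_mul_eq_one_left hb1]
  rfl

/-- A unit field that is smooth off the origin agrees on the unit sphere with a smooth, bounded,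
globally Lipschitz field which is everywhere a multiple of it and vanishes at the origin. -/
lemma exists_smooth_lipschitz_cutoff [FiniteDimensional ℝ X] {b : X → X}
    (hb : ContDiffOn ℝ (⊤ : ℕ∞) b {x : X | x ≠ 0}) (hb1 : ∀ x, x ≠ 0 → ‖b x‖ = 1) :
    ∃ χ : X → ℝ, (∀ x, ‖x‖ = 1 → χ x = 1) ∧ χ 0 = 0 ∧
      ContDiff ℝ (⊤ : ℕ∞) (fun x => χ x • b x) ∧ (∀ x, ‖χ x • b x‖ ≤ 1) ∧
      ∃ K : ℝ≥0, LipschitzWith K fun x => χ x • b x := by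
  let f : ContDiffBump (0 : X) := ⟨1 / 4, 1 / 2, by norm_num, by norm_num⟩
  let g : ContDiffBump (0 : X) := ⟨1, 2, by norm_num, by norm_num⟩
  let χ : X → ℝ := fun x => (1 - f x) * g x
  have hχ : ContDiff ℝ (⊤ : ℕ∞) χ := (contDiff_const.sub f.contDiff).mul g.contDiff
  have hχ0 : χ 0 = 0 := by
    have : f 0 = 1 := f.eventuallyEq_one.self_of_nhds
    simp [χ, this]
  have hsmooth : ContDiff ℝ (⊤ : ℕ∞) (fun x => χ x • b x) := by
    rw [contDiff_iff_contDiffAt]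
    intro x
    by_cases hx : x = 0
    · subst hx
      refine (contDiffAt_const (c := (0 : X))).congr_of_eventuallyEq ?_
      filter_upwards [f.eventuallyEq_one] with y hy
      have : f y = 1 := hy
      simp [χ, this]
    · exact hχ.contDiffAt.smul (hb.contDiffAt (isOpen_ne.mem_nhds hx))
  refine ⟨χ, fun x hx => ?_, hχ0, hsmooth, fun x => ?_, ?_⟩
  · have h1 : f x = 0 := f.zero_of_le_dist (by simp [f, hx]; norm_num)
    have h2 : g x = 1 := g.one_of_mem_closedBall (by simp [g, hx])
    simp [χ, h1, h2]
  · by_cases hx : x = 0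
    · simp [hx, hχ0]
    · rw [norm_smul, hb1 x hx, mul_one, Real.norm_eq_abs,
        abs_of_nonneg (mul_nonneg (sub_nonneg.mpr f.le_one) g.nonneg)]
      exact mul_le_one₀ (by linarith [f.nonneg' x]) g.nonneg g.le_one
  · have hcs : HasCompactSupport fun x => χ x • b x :=
      (g.hasCompactSupport.mul_left (f := fun x => 1 - f x)).smul_right
    exact hsmooth.lipschitzWith_of_hasCompactSupport hcs (by simp)

end Field

section ODE

variable {E : Type*} [NormedAddCommGroup E] [NormedSpace ℝ E]

lemma exists_hasDerivAt_Ioo_of_lipschitz_of_bounded [CompleteSpace E] {B : E → E} {K L : ℝ≥0}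
    (hK : LipschitzWith K B) (hL : ∀ x, ‖B x‖ ≤ L) (x₀ : E) {T : ℝ} (hT : 0 < T) :
    ∃ φ : ℝ → E, φ 0 = x₀ ∧ ∀ t ∈ Ioo (-T) T, HasDerivAt φ (B (φ t)) t := by
  have hmem : (0 : ℝ) ∈ Icc (-T) T := ⟨by linarith, hT.le⟩
  have hpl : IsPicardLindelof (fun _ => B) (⟨0, hmem⟩ : Icc (-T) T) x₀ (L * T.toNNReal) 0 L K :=
    .of_time_independent (fun x _ => hL x) hK.lipschitzOnWith (by simp [hT.le])
  obtain ⟨φ, h0, hφ⟩ := hpl.exists_eq_forall_mem_Icc_hasDerivWithinAt₀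
  exact ⟨φ, h0, fun t ht =>
    (hφ t (Ioo_subset_Icc_self ht)).hasDerivAt (Icc_mem_nhds ht.1 ht.2)⟩

lemma contDiff_infty_of_hasDerivAt_smul_comp {m : ℝ → ℝ} {B : E → E} {η : ℝ → E}
    (hm : ContDiff ℝ (⊤ : ℕ∞) m) (hB : ContDiff ℝ (⊤ : ℕ∞) B)
    (hη : ∀ t, HasDerivAt η (m t • B (η t)) t) : ContDiff ℝ (⊤ : ℕ∞) η := by
  have hderiv : deriv η = fun t => m t • B (η t) := funext fun t => (hη t).deriv
  have hd : Differentiable ℝ η := fun t => (hη t).differentiableAt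
  rw [contDiff_infty]
  intro n
  induction n with
  | zero => exact_mod_cast contDiff_zero.mpr hd.continuous
  | succ n ih =>
    rw [Nat.cast_succ, contDiff_succ_iff_deriv]
    refine ⟨hd, fun h => by simp at h, ?_⟩
    rw [hderiv]
    exact (contDiff_infty.mp hm n).smul ((contDiff_infty.mp hB n).comp ih)

lemma norm_eq_of_hasDerivAt_tangent {η η' : ℝ → E}
    (hdiff : ∀ x : E, x ≠ 0 → DifferentiableAt ℝ (fun x : E => ‖x‖) x)
    (hη : ∀ t, HasDerivAt η (η' t) t) (hzero : ∀ t, η t = 0 → η' t = 0)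
    (htan : ∀ t, η t ≠ 0 → fderiv ℝ (fun x : E => ‖x‖) (η t) (η' t) = 0) (s t : ℝ) :
    ‖η s‖ = ‖η t‖ := by
  have h : ∀ t, HasDerivAt (fun t => ‖η t‖) 0 t := fun t => by
    by_cases h0 : η t = 0
    · have h1 := hη t
      rw [hzero t h0, hasDerivAt_iff_isLittleO] at h1
      rw [hasDerivAt_iff_isLittleO]
      simpa [h0] using h1
    · have := (hdiff _ h0).hasFDerivAt.comp_hasDerivAt t (hη t)
      rwa [htan t h0] at this
  exact is_const_of_deriv_eq_zero (fun t => (h t).differentiableAt) (fun t => (h t).deriv) s t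

lemma hasDerivAt_integral_of_continuous [CompleteSpace E] {f : ℝ → E} (hf : Continuous f)
    (a t : ℝ) : HasDerivAt (fun u => ∫ x in a..u, f x) (f t) t :=
  intervalIntegral.integral_hasDerivAt_right (hf.intervalIntegrable _ _)
    hf.aestronglyMeasurable.stronglyMeasurableAtFilter hf.continuousAt

lemma contDiff_infty_integral [CompleteSpace E] {f : ℝ → E} (hf : ContDiff ℝ (⊤ : ℕ∞) f) (a : ℝ) :
    ContDiff ℝ (⊤ : ℕ∞) (fun u => ∫ x in a..u, f x) := by
  have h := hasDerivAt_integral_of_continuous hf.continuous a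
  rw [contDiff_infty_iff_deriv]
  refine ⟨fun t => (h t).differentiableAt, ?_⟩
  rwa [show deriv (fun u => ∫ x in a..u, f x) = f from funext fun t => (h t).deriv]

/-- A smooth function agrees near a compact set with a bounded smooth function. -/
lemma exists_contDiff_bounded_eventuallyEq {k : ℝ → ℝ} (hk : ContDiff ℝ (⊤ : ℕ∞) k) {s : Set ℝ}
    (hs : IsCompact s) :
    ∃ (T : ℝ) (θ : ℝ → ℝ), 0 < T ∧ ContDiff ℝ (⊤ : ℕ∞) θ ∧ (∀ t, θ t ∈ Ioo (-T) T) ∧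
      (∀ t, k t = 0 → θ t = 0) ∧ ∀ t ∈ s, θ =ᶠ[𝓝 t] k := by
  obtain ⟨C, hC⟩ := hs.exists_bound_of_continuousOn hk.continuous.continuousOn
  let f : ContDiffBump (0 : ℝ) := ⟨|C| + 1, |C| + 2, by positivity, by linarith⟩
  refine ⟨|C| + 2, fun t => f (k t) * k t, by positivity, (f.contDiff.comp hk).mul hk,
    fun t => ?_, fun t ht => by simp [ht], fun t ht => ?_⟩
  · rw [mem_Ioo, ← abs_lt, abs_mul, abs_of_nonneg f.nonneg]
    rcases lt_or_ge |k t| (|C| + 2) with h | h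
    · exact (mul_le_of_le_one_left (abs_nonneg _) f.le_one).trans_lt h
    · rw [f.zero_of_le_dist (by simpa [f] using h), zero_mul]
      positivity
  · have hmem : k t ∈ Metric.ball (0 : ℝ) f.rIn := by
      have := hC t ht
      have := le_abs_self C
      simp only [mem_ball_zero_iff, f]
      linarith
    filter_upwards [hk.continuous.continuousAt (f.eventuallyEq_one_of_mem_ball hmem)] with u hu
    have : f (k u) = 1 := hu
    simp [this]

/-- The equation `η' = κ B(η)` has a smooth curve, defined on the whole line, which solves it on a
prescribed compact set and is everywhere a reparametrized trajectory of `B`. -/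
lemma exists_contDiff_hasDerivAt_smul_comp [CompleteSpace E] {B : E → E} {K L : ℝ≥0}
    (hB : ContDiff ℝ (⊤ : ℕ∞) B) (hK : LipschitzWith K B) (hL : ∀ x, ‖B x‖ ≤ L) {κ : ℝ → ℝ}
    (hκ : ContDiff ℝ (⊤ : ℕ∞) κ) (x₀ : E) {s : Set ℝ} (hs : IsCompact s) :
    ∃ (m : ℝ → ℝ) (η : ℝ → E), ContDiff ℝ (⊤ : ℕ∞) η ∧ η 0 = x₀ ∧
      (∀ t, HasDerivAt η (m t • B (η t)) t) ∧ ∀ t ∈ s, m t = κ t := by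
  obtain ⟨T, θ, hT, hθ, hθT, hθ0, hθs⟩ :=
    exists_contDiff_bounded_eventuallyEq (contDiff_infty_integral hκ 0) hs
  obtain ⟨φ, hφ0, hφ⟩ := exists_hasDerivAt_Ioo_of_lipschitz_of_bounded hK hL x₀ hT
  have hη : ∀ t, HasDerivAt (φ ∘ θ) (deriv θ t • B ((φ ∘ θ) t)) t := fun t =>
    (hφ _ (hθT t)).scomp t (hθ.differentiable (by simp) t).hasDerivAt
  refine ⟨deriv θ, φ ∘ θ, contDiff_infty_of_hasDerivAt_smul_comp
    (contDiff_infty_iff_deriv.mp hθ).2 hB hη, by simp [hθ0 0, hφ0], hη, fun t ht => ?_⟩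
  rw [(hθs t ht).deriv_eq]
  exact (hasDerivAt_integral_of_continuous hκ.continuous 0 t).deriv

lemma eqOn_Icc_of_deriv_eq_smul_comp {B : E → E} {K : ℝ≥0} (hK : LipschitzWith K B)
    {κ : ℝ → ℝ} (hκ : Continuous κ) {a c : ℝ} {f g : ℝ → E}
    (hf : ∀ t ∈ Icc a c, HasDerivAt f (κ t • B (f t)) t)
    (hg : ∀ t ∈ Icc a c, HasDerivAt g (κ t • B (g t)) t) (h : f a = g a) :
    EqOn f g (Icc a c) := by
  obtain ⟨C, hC⟩ := isCompact_Icc.exists_bound_of_continuousOn (hκ.continuousOn (s := Icc a c))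
  refine ODE_solution_unique_of_mem_Icc_right (v := fun t x => κ t • B x) (s := fun _ => univ)
    (K := C.toNNReal * K)
    (fun t ht => ?_) (fun t ht => (hf t ht).continuousAt.continuousWithinAt)
    (fun t ht => (hf t (Ico_subset_Icc_self ht)).hasDerivWithinAt) (fun _ _ => mem_univ _)
    (fun t ht => (hg t ht).continuousAt.continuousWithinAt)
    (fun t ht => (hg t (Ico_subset_Icc_self ht)).hasDerivWithinAt) (fun _ _ => mem_univ _) h
  rw [lipschitzOnWith_univ]
  refine LipschitzWith.of_dist_le_mul fun x y => ?_
  rw [dist_smul₀, NNReal.coe_mul, mul_assoc]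
  have hC' : ‖κ t‖ ≤ C.toNNReal :=
    (hC t (Ico_subset_Icc_self ht)).trans (Real.le_coe_toNNReal C)
  exact mul_le_mul hC' (hK.dist_le_mul x y) dist_nonneg (NNReal.coe_nonneg _)

end ODE

theorem legendre_existence_uniqueness
    [NormedAddCommGroup X] [NormedSpace ℝ X] [FiniteDimensional ℝ X]
    [StrictConvexSpace ℝ X]
    (hdim : Module.finrank ℝ X = 2)
    (hnorm : ContDiffOn ℝ (⊤ : ℕ∞) (fun x : X => ‖x‖) {x : X | x ≠ 0})
    (ω : X →ₗ[ℝ] X →ₗ[ℝ] ℝ) (hωalt : ∀ x : X, ω x x = 0)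
    (hωnd : ∀ x : X, x ≠ 0 → ∃ y : X, ω x y ≠ 0)
    (b : X → X)
    (hb : ∀ v : X, v ≠ 0 → ‖b v‖ = 1 ∧ BirkhoffOrth v (b v) ∧ 0 < ω v (b v))
    (c : ℝ) (hc : 0 < c) (α κ : ℝ → ℝ)
    (hα : ContDiff ℝ (⊤ : ℕ∞) α) (hκ : ContDiff ℝ (⊤ : ℕ∞) κ)
    (p v : X) (hv : ‖v‖ = 1) :
    ∃ γ η : ℝ → X,
      (ContDiff ℝ (⊤ : ℕ∞) γ ∧ ContDiff ℝ (⊤ : ℕ∞) η ∧ γ 0 = p ∧ η 0 = v ∧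
        ∀ t ∈ Set.Icc (0:ℝ) c,
          ‖η t‖ = 1 ∧ BirkhoffOrth (η t) (deriv γ t) ∧
          deriv γ t = α t • b (η t) ∧ deriv η t = κ t • b (η t)) ∧
      (∀ γ₂ η₂ : ℝ → X,
        (ContDiff ℝ (⊤ : ℕ∞) γ₂ ∧ ContDiff ℝ (⊤ : ℕ∞) η₂ ∧ γ₂ 0 = p ∧ η₂ 0 = v ∧
          ∀ t ∈ Set.Icc (0:ℝ) c,
            ‖η₂ t‖ = 1 ∧ BirkhoffOrth (η₂ t) (deriv γ₂ t) ∧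
            deriv γ₂ t = α t • b (η₂ t) ∧ deriv η₂ t = κ t • b (η₂ t)) →
        ∀ t ∈ Set.Icc (0:ℝ) c, γ₂ t = γ t ∧ η₂ t = η t) := by
  have hbs := contDiffOn_birkhoff hdim hnorm ω hωalt hωnd b hb
  have hdiff : ∀ x : X, x ≠ 0 → DifferentiableAt ℝ (fun x : X => ‖x‖) x := fun x hx =>
    (hnorm.contDiffAt (isOpen_ne.mem_nhds hx)).differentiableAt (by simp)
  obtain ⟨χ, hχ1, hχ0, hB, hB1, K, hK⟩ :=
    exists_smooth_lipschitz_cutoff hbs fun x hx => (hb x hx).1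
  have hBb : ∀ x : X, ‖x‖ = 1 → χ x • b x = b x := fun x hx => by rw [hχ1 x hx, one_smul]
  have hborth : ∀ (x : X) (r : ℝ), ‖x‖ = 1 → BirkhoffOrth x (r • b x) := fun x r hx =>
    ((hb x (norm_ne_zero_iff.mp (by simp [hx]))).2.1).smul_right r
  obtain ⟨m, η, hηs, hη0, hη, hm⟩ := exists_contDiff_hasDerivAt_smul_comp (L := 1) hB hK
    (by simpa using hB1) hκ v (isCompact_Icc (a := 0) (b := c))
  have hη1 : ∀ t, ‖η t‖ = 1 := fun t => by
    rw [norm_eq_of_hasDerivAt_tangent hdiff hη (fun t ht => by simp [ht, hχ0])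
      (fun t ht => ?_) t 0, hη0, hv]
    simp [(hb _ ht).2.1.fderiv_norm_eq_zero (hdiff _ ht)]
  have hγ's : ContDiff ℝ (⊤ : ℕ∞) fun t => α t • (χ (η t) • b (η t)) := hα.smul (hB.comp hηs)
  have hγ : ∀ t, HasDerivAt (fun u => p + ∫ x in (0 : ℝ)..u, α x • (χ (η x) • b (η x)))
      (α t • b (η t)) t := fun t => by
    rw [← hBb _ (hη1 t)]
    exact (hasDerivAt_integral_of_continuous hγ's.continuous 0 t).const_add p
  refine ⟨fun u => p + ∫ x in (0 : ℝ)..u, α x • (χ (η x) • b (η x)), η,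
    ⟨contDiff_const.add (contDiff_infty_integral hγ's 0), hηs, by simp, hη0, fun t ht =>
      ⟨hη1 t, ?_, (hγ t).deriv, ?_⟩⟩, ?_⟩
  · rw [(hγ t).deriv]
    exact hborth _ _ (hη1 t)
  · rw [(hη t).deriv, hm t ht, hBb _ (hη1 t)]
  · rintro γ₂ η₂ ⟨hγ₂s, hη₂s, hγ₂0, hη₂0, h₂⟩
    have hηeq : EqOn η₂ η (Icc 0 c) := by
      refine eqOn_Icc_of_deriv_eq_smul_comp hK hκ.continuous (fun t ht => ?_) (fun t ht => ?_)
        (hη₂0.trans hη0.symm)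
      · obtain ⟨h1, -, -, h4⟩ := h₂ t ht
        rw [hBb _ h1, ← h4]
        exact (hη₂s.differentiable (by simp) t).hasDerivAt
      · rw [← hm t ht]
        exact hη t
    have hγeq : EqOn γ₂ (fun u => p + ∫ x in (0 : ℝ)..u, α x • (χ (η x) • b (η x)))
        (Icc 0 c) := by
      refine ODE_solution_unique_of_mem_Icc_right (v := fun t _ => α t • b (η t))
        (s := fun _ => univ) (K := 0) (fun t _ => (LipschitzWith.const _).lipschitzOnWith)
        hγ₂s.continuous.continuousOn (fun t ht => ?_) (fun _ _ => mem_univ _)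
        (fun t _ => (hγ t).continuousAt.continuousWithinAt)
        (fun t _ => (hγ t).hasDerivWithinAt) (fun _ _ => mem_univ _) (by simp [hγ₂0])
      have ht' := Ico_subset_Icc_self ht
      rw [← hηeq ht', ← (h₂ t ht').2.2.1]
      exact (hγ₂s.differentiable (by simp) t).hasDerivAt.hasDerivWithinAt
    exact fun t ht => ⟨hγeq ht, hηeq ht⟩
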